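/- Fix a ∈ [0,1) and σ > 0. There exist constants c, c₁, c₂ > 0 (c universal; c₁, c₂ depending only on a) such that for every η ∈ (0,1) and all sufficiently large n, the maximum likelihood estimator satisfies P[ |â(U^n) − a| > η ] ≤ 2 exp( −c·min(c₁ η² n, c₂ η n) ), where U^n is the n-sample vector of the Gauss-Markov source. -/

import Mathlib

open MeasureTheory ProbabilityTheory Real Filter Matrix
open scoped NNReal ENNReal

noncomputable section

namespace GM

/-- Law of `n` i.i.d. centered Gaussian random variables with variance `σ²`. -/
def gaussPi (σ : ℝ) (n : ℕ) : Measure (Fin n → ℝ) :=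
  Measure.pi fun _ => gaussianReal 0 ⟨σ ^ 2, sq_nonneg σ⟩

/-- The Gauss-Markov evolution `U_{i+1} = ∑_{j ≤ i} a^(i-j) Z_{j+1}`
(equivalently `U_0 = 0`, `U_i = a U_{i-1} + Z_i`). -/
def evolve (a : ℝ) (n : ℕ) (z : Fin n → ℝ) : Fin n → ℝ :=
  fun i => ∑ j ∈ Finset.Iic i, a ^ ((i : ℕ) - (j : ℕ)) * z j

/-- Law of the Gauss-Markov source vector `(U_1, …, U_n)`. -/
def sourceLaw (a σ : ℝ) (n : ℕ) : Measure (Fin n → ℝ) :=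
  (gaussPi σ n).map (evolve a n)

/-- Mean squared error distortion. -/
def distortion (n : ℕ) (u v : Fin n → ℝ) : ℝ :=
  (1 / (n : ℝ)) * ∑ i, (u i - v i) ^ 2

/-- There exists an `(n, M, d, ε)` excess-distortion code for the Gauss-Markov source. -/
def IsCode (a σ : ℝ) (n M : ℕ) (d ε : ℝ) : Prop :=
  ∃ f : (Fin n → ℝ) → Fin M, ∃ g : Fin M → (Fin n → ℝ),
    Measurable f ∧
    sourceLaw a σ n {u | d < distortion n u (g (f u))} ≤ ENNReal.ofReal ε

/-- Minimum achievable code size. -/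
def Mstar (a σ : ℝ) (n : ℕ) (d ε : ℝ) : ℕ := sInf {M | IsCode a σ n M d ε}

/-- Minimum achievable source coding rate `R(n, d, ε)`. -/
def rate (a σ : ℝ) (n : ℕ) (d ε : ℝ) : ℝ := Real.log (Mstar a σ n d ε) / n

/-- Gaussian tail function `Q`. -/
def gaussQ (t : ℝ) : ℝ := ∫ s in Set.Ioi t, (Real.sqrt (2 * π))⁻¹ * Real.exp (-(s ^ 2) / 2)

/-- Power spectrum of the Gauss-Markov source. -/
def S (a σ w : ℝ) : ℝ := σ ^ 2 / (1 + a ^ 2 - 2 * a * Real.cos w)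

/-- The limiting reverse waterfilling equation relating distortion `d` and water level `θ`. -/
def waterEq (a σ θ d : ℝ) : Prop :=
  d = (1 / (2 * π)) * ∫ w in Set.Icc (-π) π, min θ (S a σ w)

/-- The rate-distortion function `R_U(d)`, parametrized by the water level `θ` matched to `d`. -/
def RU (a σ θ : ℝ) : ℝ :=
  (1 / (2 * π)) * ∫ w in Set.Icc (-π) π, max 0 ((1 / 2) * Real.log (S a σ w / θ))

/-- The dispersion `V_U(d)`, parametrized by the water level `θ` matched to `d`. -/
def VU (a σ θ : ℝ) : ℝ :=
  (1 / (4 * π)) * ∫ w in Set.Icc (-π) π, min 1 ((S a σ w / θ) ^ 2)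

/-- The lower bidiagonal matrix `A` with `1` on the diagonal, `-a` on the first subdiagonal. -/
def Amat (a : ℝ) (n : ℕ) : Matrix (Fin n) (Fin n) ℝ :=
  Matrix.of fun i j => if i = j then 1 else if (i : ℕ) = (j : ℕ) + 1 then -a else 0

/-- `μv` is the nondecreasing enumeration of the eigenvalues (with multiplicity) of the
real symmetric matrix `M`: it is monotone and `M = P D Pᵀ` for some orthogonal `P`. -/
def IsEigs {n : ℕ} (μv : Fin n → ℝ) (M : Matrix (Fin n) (Fin n) ℝ) : Prop :=
  Monotone μv ∧ ∃ P : Matrix (Fin n) (Fin n) ℝ,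
    P * Pᵀ = 1 ∧ Pᵀ * P = 1 ∧ M = P * Matrix.diagonal μv * Pᵀ

/-- The `i`-th entry of `u` (0-based), or `0` if out of range. -/
def entry {n : ℕ} (u : Fin n → ℝ) (i : ℕ) : ℝ := if h : i < n then u ⟨i, h⟩ else 0

/-- Maximum likelihood estimator `â(u) = (∑_{i=1}^{n-1} u_i u_{i+1}) / (∑_{i=1}^{n-1} u_i²)`. -/
def mle {n : ℕ} (u : Fin n → ℝ) : ℝ :=
  (∑ i ∈ Finset.range (n - 1), entry u i * entry u (i + 1)) /
    ∑ i ∈ Finset.range (n - 1), entry u i ^ 2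

/-- The `d`-tilted information expression, parametrized by a water level `θ`,
per-coordinate variances `sv`, evaluated at the point `x`. -/
def Jtilt {n : ℕ} (θ : ℝ) (sv : Fin n → ℝ) (x : Fin n → ℝ) : ℝ :=
  ∑ i, ((min θ (sv i) / (2 * θ)) * ((x i) ^ 2 / sv i - 1)
        + (1 / 2) * Real.log (max θ (sv i) / θ))

end GM

namespace GM8

/-- Exponent functional, started at state `x`. -/
def T (a s p : ℝ) : (n : ℕ) → ℝ → (Fin n → ℝ) → ℝ
  | 0, _, _ => 0
  | n + 1, x, z => (s * x * z 0 - p * x ^ 2) + T a s p n (a * x + z 0) (fun i => z i.succ)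

lemma T_meas (a s p : ℝ) (n : ℕ) :
    Measurable (fun q : ℝ × (Fin n → ℝ) => T a s p n q.1 q.2) := by
  induction n with
  | zero => simp only [T]; fun_prop
  | succ n ih =>
    simp only [T]
    have h2 : Measurable (fun q : ℝ × (Fin (n+1) → ℝ) =>
        ((a * q.1 + q.2 0, fun i : Fin n => q.2 i.succ) : ℝ × (Fin n → ℝ))) := by fun_prop
    have := ih.comp h2
    refine Measurable.add (by fun_prop) this

lemma T_eq (a s p : ℝ) (n : ℕ) : ∀ (x : ℝ) (z : Fin n → ℝ) (U : ℕ → ℝ), U 0 = x →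
    (∀ i < n, U (i + 1) = a * U i + GM.entry z i) →
    T a s p n x z = ∑ i ∈ Finset.range n, (s * U i * (U (i + 1) - a * U i) - p * U i ^ 2) := by
  induction n with
  | zero => intros; simp [T]
  | succ n ih =>
    intro x z U h0 hU
    have h1 := hU 0 (by omega)
    have hz : GM.entry z 0 = z 0 := by simp [GM.entry]
    rw [Finset.sum_range_succ', T, ih (a * x + z 0) (fun i => z i.succ) (fun i => U (i + 1))]
    · simp only [zero_add] at h1 ⊢
      rw [h1, h0, hz]; ring
    · simp only [zero_add] at h1 ⊢
      rw [h1, h0, hz]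
    · intro i hi
      have := hU (i + 1) (by omega)
      simp only [this]
      congr 1
      simp [GM.entry, hi]

lemma entry_evolve (a : ℝ) (n : ℕ) (z : Fin n → ℝ) (i : ℕ) (hi : i < n) :
    GM.entry (GM.evolve a n z) i = ∑ j ∈ Finset.range (i + 1), a ^ (i - j) * GM.entry z j := by
  have : Finset.range (i + 1) = (Finset.Iic (⟨i, hi⟩ : Fin n)).map Fin.valEmbedding := by
    rw [Fin.map_valEmbedding_Iic]; ext; simp [Nat.lt_succ_iff]
  rw [this, Finset.sum_map]
  simp [GM.entry, hi, GM.evolve]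

lemma entry_rec (a : ℝ) (n : ℕ) (z : Fin n → ℝ) (i : ℕ) (hi : i + 1 < n) :
    GM.entry (GM.evolve a n z) (i + 1) = a * GM.entry (GM.evolve a n z) i + GM.entry z (i + 1) := by
  rw [entry_evolve _ _ _ _ hi, entry_evolve _ _ _ _ (by omega), Finset.sum_range_succ,
    Finset.mul_sum]
  congr 1
  · refine Finset.sum_congr rfl fun j hj => ?_
    have : j ≤ i := by simpa [Nat.lt_succ_iff] using hj
    rw [Nat.sub_add_comm this, pow_succ]; ring
  · simp

lemma T_evolve (a s p : ℝ) (n : ℕ) (z : Fin (n + 1) → ℝ) :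
    T a s p (n + 1) 0 z = ∑ i ∈ Finset.range n,
      (s * GM.entry (GM.evolve a (n + 1) z) i * (GM.entry (GM.evolve a (n + 1) z) (i + 1)
        - a * GM.entry (GM.evolve a (n + 1) z) i) - p * GM.entry (GM.evolve a (n + 1) z) i ^ 2) := by
  rw [T_eq a s p (n + 1) 0 z
    (fun i => Nat.casesOn i 0 (fun j => GM.entry (GM.evolve a (n + 1) z) j)) rfl,
    Finset.sum_range_succ']
  · simp
  · intro i hi
    cases i with
    | zero => simp [entry_evolve]
    | succ i => exact entry_rec a _ z i hi

lemma step (a s x k : ℝ) (v : ℝ≥0) (hv : v ≠ 0) (hk : 0 ≤ k) :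
    ∫⁻ z, ENNReal.ofReal (rexp (s * x * z - s ^ 2 * v * x ^ 2 - k * (a * x + z) ^ 2))
      ∂(gaussianReal 0 v) ≤
    ENNReal.ofReal (√(1 / (1 + 2 * v * k)) * rexp (-(s ^ 2 * v / 2) * x ^ 2)) := by
  have hv0 : (0 : ℝ) < v := by positivity
  set g : ℝ≥0 := ⟨1 + 2 * v * k, by positivity⟩ with hg
  have hg1 : (g : ℝ) = 1 + 2 * v * k := rfl
  have hgp : (0 : ℝ) < g := by rw [hg1]; positivity
  have hg0 : g ≠ 0 := by intro h; simp [h] at hgp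
  rw [gaussianReal_of_var_ne_zero _ hv, lintegral_withDensity_eq_lintegral_mul _
    (measurable_gaussianPDF _ _) (by fun_prop), ← hg1]
  set m : ℝ := s * v * x - (2 * v * k / g) * (a + s * v) * x with hm
  calc _ ≤ ∫⁻ z, ENNReal.ofReal (√(1 / g) * rexp (-(s ^ 2 * v / 2) * x ^ 2)) *
        ENNReal.ofReal (gaussianPDFReal m (v / g) z) := by
        refine lintegral_mono fun z => ?_
        simp only [Pi.mul_apply, gaussianPDF]
        rw [← ENNReal.ofReal_mul (gaussianPDFReal_nonneg _ _ _),
          ← ENNReal.ofReal_mul (by positivity)]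
        refine ENNReal.ofReal_le_ofReal ?_
        simp only [gaussianPDFReal]
        have e1 : (√(2 * π * v))⁻¹ = √(1 / g) * (√(2 * π * ((v / g : ℝ≥0) : ℝ)))⁻¹ := by
          rw [← Real.sqrt_inv, ← Real.sqrt_inv, ← Real.sqrt_mul (by positivity)]
          congr 1
          push_cast
          field_simp
        rw [e1]
        have e2 : -(z - 0) ^ 2 / (2 * v) + (s * x * z - s ^ 2 * v * x ^ 2 - k * (a * x + z) ^ 2)
            ≤ -(s ^ 2 * v / 2) * x ^ 2 + -(z - m) ^ 2 / (2 * ((v / g : ℝ≥0) : ℝ)) := by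
          have : -(s ^ 2 * v / 2) * x ^ 2 + -(z - m) ^ 2 / (2 * ((v / g : ℝ≥0) : ℝ)) -
              (-(z - 0) ^ 2 / (2 * v) + (s * x * z - s ^ 2 * v * x ^ 2 - k * (a * x + z) ^ 2))
              = k * ((a + s * v) * x) ^ 2 / g := by
            rw [hm]; push_cast; field_simp; rw [hg1]; ring
          have h2 : 0 ≤ k * ((a + s * v) * x) ^ 2 / g := by positivity
          linarith
        have e3 := Real.exp_le_exp.2 e2
        rw [Real.exp_add, Real.exp_add] at e3
        have h0 : 0 ≤ √(1 / (g : ℝ)) * (√(2 * π * ((v / g : ℝ≥0) : ℝ)))⁻¹ := by positivity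
        calc _ = √(1 / (g : ℝ)) * (√(2 * π * ((v / g : ℝ≥0) : ℝ)))⁻¹ * (rexp (-(z - 0) ^ 2 / (2 * v)) *
              rexp (s * x * z - s ^ 2 * v * x ^ 2 - k * (a * x + z) ^ 2)) := by ring
          _ ≤ _ := mul_le_mul_of_nonneg_left e3 h0
          _ = _ := by ring
    _ = _ := by
        rw [lintegral_const_mul _ (by fun_prop), lintegral_gaussianPDFReal_eq_one _ (by positivity),
          mul_one]

lemma main (a s : ℝ) (v : ℝ≥0) (hv : v ≠ 0) (n : ℕ) : ∀ x : ℝ,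
    ∫⁻ z, ENNReal.ofReal (rexp (T a s (s ^ 2 * v) (n + 1) x z))
      ∂(Measure.pi fun _ : Fin (n + 1) => gaussianReal 0 v) ≤
    ENNReal.ofReal (√(1 / (1 + s ^ 2 * v ^ 2)) ^ n * rexp (-(s ^ 2 * v / 2) * x ^ 2)) := by
  have red : ∀ (n : ℕ) (x : ℝ), ∫⁻ z, ENNReal.ofReal (rexp (T a s (s ^ 2 * v) (n + 1) x z))
      ∂(Measure.pi fun _ : Fin (n + 1) => gaussianReal 0 v) =
      ∫⁻ y, ENNReal.ofReal (rexp (s * x * y - s ^ 2 * v * x ^ 2)) *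
        ∫⁻ w, ENNReal.ofReal (rexp (T a s (s ^ 2 * v) n (a * x + y) w))
          ∂(Measure.pi fun _ : Fin n => gaussianReal 0 v) ∂(gaussianReal 0 v) := by
    intro n x
    have mp := measurePreserving_piFinSuccAbove (fun _ : Fin (n + 1) => gaussianReal 0 v) 0
    have hm : Measurable (fun q : ℝ × (Fin n → ℝ) =>
        ENNReal.ofReal (rexp (s * x * q.1 - s ^ 2 * v * x ^ 2)) *
        ENNReal.ofReal (rexp (T a s (s ^ 2 * v) n (a * x + q.1) q.2))) := by
      have h2 : Measurable (fun q : ℝ × (Fin n → ℝ) => ((a * x + q.1, q.2) : ℝ × (Fin n → ℝ))) := by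
        fun_prop
      have h3 := (T_meas a s (s ^ 2 * v) n).comp h2
      exact Measurable.mul (by fun_prop) (Real.measurable_exp.comp h3).ennreal_ofReal
    have h := mp.lintegral_comp hm
    rw [lintegral_prod _ hm.aemeasurable] at h
    rw [← lintegral_congr (fun y => lintegral_const_mul _ ?_)]
    · refine Eq.trans ?_ h
      refine lintegral_congr fun z => ?_
      rw [← ENNReal.ofReal_mul (by positivity), ← Real.exp_add]
      rfl
    · have h2 : Measurable (fun q : (Fin n → ℝ) => ((a * x + y, q) : ℝ × (Fin n → ℝ))) := by
        fun_prop
      exact (Real.measurable_exp.comp ((T_meas a s (s ^ 2 * v) n).comp h2)).ennreal_ofReal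
  induction n with
  | zero =>
    intro x
    rw [red]
    have := step a s x 0 v hv le_rfl
    simpa [T] using this
  | succ n ih =>
    intro x
    rw [red]
    set r := √(1 / (1 + s ^ 2 * (v : ℝ) ^ 2)) with hr
    have hst := step a s x (s ^ 2 * v / 2) v hv (by positivity)
    rw [show 1 + 2 * (v : ℝ) * (s ^ 2 * v / 2) = 1 + s ^ 2 * (v : ℝ) ^ 2 by ring, ← hr] at hst
    calc _ ≤ ∫⁻ y, ENNReal.ofReal (r ^ n) * ENNReal.ofReal (rexp (s * x * y - s ^ 2 * v * x ^ 2 -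
            (s ^ 2 * v / 2) * (a * x + y) ^ 2)) ∂(gaussianReal 0 v) := by
          refine lintegral_mono fun y => ?_
          refine (mul_le_mul_right (ih (a * x + y)) _).trans (le_of_eq ?_)
          rw [← ENNReal.ofReal_mul (by positivity), ← ENNReal.ofReal_mul (by positivity)]
          congr 1
          rw [sub_eq_add_neg (s * x * y - s ^ 2 * v * x ^ 2), Real.exp_add,
            neg_mul]
          ring
      _ = ENNReal.ofReal (r ^ n) * ∫⁻ y, ENNReal.ofReal (rexp (s * x * y - s ^ 2 * v * x ^ 2 -
            (s ^ 2 * v / 2) * (a * x + y) ^ 2)) ∂(gaussianReal 0 v) := by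
          rw [lintegral_const_mul _ (by fun_prop)]
      _ ≤ ENNReal.ofReal (r ^ n) * _ := mul_le_mul_right hst _
      _ = _ := by
          rw [← ENNReal.ofReal_mul (by positivity), pow_succ r n, mul_assoc (r ^ n)]

lemma sqrt_bound (h : ℝ) (h0 : 0 ≤ h) (h1 : h ≤ 1) : √(1 / (1 + h)) ≤ rexp (-(h / 4)) := by
  rw [Real.sqrt_le_left (Real.exp_pos _).le, ← Real.exp_nat_mul]
  have e : ((2 : ℕ) : ℝ) * -(h / 4) = -(h / 2) := by push_cast; ring
  rw [e]
  have := Real.add_one_le_exp (-(h / 2))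
  refine le_trans ?_ this
  rw [div_le_iff₀ (by linarith)]
  nlinarith

lemma tail (a σ η s : ℝ) (hσ : 0 < σ) (h0 : 0 < η) (h1 : η < 1) (hs : (s * σ ^ 2) ^ 2 = η ^ 2)
    (n : ℕ) (hn : 1 ≤ n) :
    GM.gaussPi σ (n + 1) {z | 0 ≤ T a s (s ^ 2 * σ ^ 2) (n + 1) 0 z} ≤
      ENNReal.ofReal (rexp (-(1 / 8 * η ^ 2 * (n + 1 : ℕ)))) := by
  set v : ℝ≥0 := ⟨σ ^ 2, sq_nonneg σ⟩ with hv
  have hv1 : (v : ℝ) = σ ^ 2 := rfl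
  have hv0 : v ≠ 0 := by
    intro h
    have : (v : ℝ) = 0 := by rw [h]; rfl
    rw [hv1] at this
    exact (pow_pos hσ 2).ne' this
  have hmain := main a s v hv0 n 0
  have hmeas : Measurable (fun z : Fin (n + 1) → ℝ =>
      ENNReal.ofReal (rexp (T a s (s ^ 2 * v) (n + 1) 0 z))) := by
    have h2 : Measurable (fun q : (Fin (n + 1) → ℝ) => ((0, q) : ℝ × (Fin (n + 1) → ℝ))) := by
      fun_prop
    exact (Real.measurable_exp.comp ((T_meas a s (s ^ 2 * v) (n + 1)).comp h2)).ennreal_ofReal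
  have hmk := mul_meas_ge_le_lintegral (μ := GM.gaussPi σ (n + 1)) hmeas 1
  rw [one_mul] at hmk
  refine le_trans (measure_mono ?_) (hmk.trans (hmain.trans ?_))
  · intro z hz
    simp only [Set.mem_setOf_eq] at hz ⊢
    rw [ENNReal.one_le_ofReal, Real.one_le_exp_iff, hv1]
    exact hz
  · refine ENNReal.ofReal_le_ofReal ?_
    have e : s ^ 2 * (v : ℝ) ^ 2 = η ^ 2 := by rw [hv1, ← hs]; ring
    rw [e]
    have hb := sqrt_bound (η ^ 2) (by positivity) (by nlinarith)
    have hb2 := pow_le_pow_left₀ (Real.sqrt_nonneg _) hb n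
    rw [← Real.exp_nat_mul] at hb2
    simp only [ne_eq, OfNat.ofNat_ne_zero, not_false_eq_true, zero_pow, mul_zero, Real.exp_zero,
      mul_one]
    refine hb2.trans (Real.exp_le_exp.2 ?_)
    push_cast
    have : (1 : ℝ) ≤ n := by exact_mod_cast hn
    nlinarith [sq_nonneg η, mul_nonneg (sq_nonneg η) (sub_nonneg.2 this)]

lemma entry_meas (n i : ℕ) : Measurable (fun u : Fin n → ℝ => GM.entry u i) := by
  unfold GM.entry
  split_ifs <;> fun_prop

lemma mle_meas (n : ℕ) : Measurable (fun u : Fin n → ℝ => GM.mle u) := by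
  unfold GM.mle
  refine Measurable.div ?_ ?_
  · exact Finset.measurable_sum _ fun i _ => (entry_meas n i).mul (entry_meas n (i + 1))
  · exact Finset.measurable_sum _ fun i _ => (entry_meas n i).pow_const 2

lemma evolve_meas (a : ℝ) (n : ℕ) : Measurable (GM.evolve a n) := by
  unfold GM.evolve
  fun_prop

lemma incl (a σ η : ℝ) (hσ : 0 < σ) (hη0 : 0 ≤ η) (n : ℕ) (z : Fin (n + 1) → ℝ)
    (h : η < |GM.mle (GM.evolve a (n + 1) z) - a|) :
    0 ≤ T a (η / σ ^ 2) ((η / σ ^ 2) ^ 2 * σ ^ 2) (n + 1) 0 z ∨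
    0 ≤ T a (-(η / σ ^ 2)) ((-(η / σ ^ 2)) ^ 2 * σ ^ 2) (n + 1) 0 z := by
  rw [T_evolve, T_evolve]
  set u := GM.evolve a (n + 1) z
  simp only [GM.mle, Nat.add_sub_cancel] at h
  set N := ∑ i ∈ Finset.range n, GM.entry u i * GM.entry u (i + 1) with hN
  set D := ∑ i ∈ Finset.range n, GM.entry u i ^ 2 with hD
  have key : ∀ s p : ℝ, ∑ i ∈ Finset.range n, (s * GM.entry u i * (GM.entry u (i + 1)
        - a * GM.entry u i) - p * GM.entry u i ^ 2) = s * (N - a * D) - p * D := by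
    intro s p
    rw [hN, hD, Finset.mul_sum, Finset.mul_sum, ← Finset.sum_sub_distrib, Finset.mul_sum,
      ← Finset.sum_sub_distrib]
    exact Finset.sum_congr rfl fun i _ => by ring
  rw [key, key]
  have hD0 : 0 ≤ D := Finset.sum_nonneg fun i _ => sq_nonneg _
  rcases hD0.eq_or_lt with hz | hpos
  · have : N = 0 := by
      refine Finset.sum_eq_zero fun i hi => ?_
      have := (Finset.sum_eq_zero_iff_of_nonneg (fun i _ => sq_nonneg (GM.entry u i))).1 hz.symm i hi
      rw [pow_eq_zero_iff two_ne_zero] at this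
      rw [this, zero_mul]
    rw [this, ← hz]; simp
  · have e : (η / σ ^ 2) ^ 2 * σ ^ 2 = η / σ ^ 2 * η := by field_simp
    rw [neg_sq, e]
    have hs : 0 ≤ η / σ ^ 2 := by positivity
    rw [lt_abs] at h
    have e2 : N / D * D = N := div_mul_cancel₀ _ hpos.ne'
    rcases h with h | h
    · left
      have := mul_lt_mul_of_pos_right h hpos
      have h3 : 0 ≤ N - a * D - η * D := by nlinarith
      have := mul_nonneg hs h3
      nlinarith
    · right
      have := mul_lt_mul_of_pos_right h hpos
      have h3 : 0 ≤ -(N - a * D) - η * D := by nlinarith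
      have := mul_nonneg hs h3
      nlinarith

end GM8

theorem stmt8 (a σ : ℝ) (ha0 : 0 ≤ a) (ha1 : a < 1) (hσ : 0 < σ) :
    ∃ c c₁ c₂ : ℝ, 0 < c ∧ 0 < c₁ ∧ 0 < c₂ ∧
      ∀ η : ℝ, η ∈ Set.Ioo (0 : ℝ) 1 →
        ∀ᶠ n : ℕ in Filter.atTop,
          GM.sourceLaw a σ n {u | η < |GM.mle u - a|} ≤
            ENNReal.ofReal (2 * Real.exp (-(c * min (c₁ * η ^ 2 * n) (c₂ * η * n)))) := by
  refine ⟨1, 1 / 8, 1, by norm_num, by norm_num, by norm_num, ?_⟩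
  rintro η ⟨h0, h1⟩
  filter_upwards [Filter.eventually_ge_atTop 2] with n hn
  obtain ⟨n, rfl⟩ : ∃ m, n = m + 1 := ⟨n - 1, by omega⟩
  have hset : MeasurableSet {u : Fin (n + 1) → ℝ | η < |GM.mle u - a|} :=
    measurableSet_lt measurable_const ((GM8.mle_meas (n + 1)).sub_const a).abs
  rw [GM.sourceLaw, Measure.map_apply (GM8.evolve_meas a (n + 1)) hset]
  have t1 := GM8.tail a σ η (η / σ ^ 2) hσ h0 h1 (by field_simp) n (by omega)
  have t2 := GM8.tail a σ η (-(η / σ ^ 2)) hσ h0 h1 (by field_simp) n (by omega)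
  refine (measure_mono (fun z hz => GM8.incl a σ η hσ h0.le n z hz)).trans ?_
  refine (measure_union_le _ _).trans ((add_le_add t1 t2).trans ?_)
  rw [← ENNReal.ofReal_add (by positivity) (by positivity)]
  refine ENNReal.ofReal_le_ofReal ?_
  rw [← two_mul]
  refine mul_le_mul_of_nonneg_left (Real.exp_le_exp.2 ?_) (by norm_num)
  rw [one_mul]
  exact neg_le_neg (min_le_left _ _)

end
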